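/- Let p ≥ 1, let λ_1, …, λ_d > 0, c ∈ ℝ^d, Λ = diag(λ), and define H on the simplex Δ_{d−1} = {y ∈ ℝ^d : yᵢ ≥ 0, Σᵢ yᵢ = 1} by H(y) = − Σ_{i=1}^d yᵢ^{1/p}·|cᵢ| − √(Σ_{i=1}^d λᵢ^{−1} yᵢ^{2/p}). For y ∈ Δ_{d−1} let x(y) ∈ ℝ^d have coordinates xᵢ = yᵢ^{1/p}·sign(cᵢ). Then ‖x(y)‖_p = 1 and −H(y) = x(y)ᵀc + ‖x(y)‖_{Λ^{−1}}; consequently, for every ε > 0, y is an ε-minimizer of H over Δ_{d−1} if and only if x(y) is an ε-maximizer of x ↦ xᵀc + ‖x‖_{Λ^{−1}} over the unit ℓ_p ball {x : ‖x‖_p ≤ 1}. -/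

import Mathlib

open Matrix Set

/-- `mNorm M z = √(zᵀ M z)`. -/
noncomputable def mNorm {d : ℕ} (M : Matrix (Fin d) (Fin d) ℝ) (z : Fin d → ℝ) : ℝ :=
  Real.sqrt (z ⬝ᵥ M *ᵥ z)

/-- `ℓ_p` norm of a vector in `ℝ^d` (real exponent `p`). -/
noncomputable def pnorm {d : ℕ} (p : ℝ) (z : Fin d → ℝ) : ℝ :=
  (∑ i, |z i| ^ p) ^ (1 / p)

/-- The simplex `Δ_{d-1} = {y : yᵢ ≥ 0, Σᵢ yᵢ = 1}`. -/
def stdSimplex' (d : ℕ) : Set (Fin d → ℝ) :=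
  {y | (∀ i, 0 ≤ y i) ∧ ∑ i, y i = 1}

/-- The objective `H(y) = -Σᵢ yᵢ^{1/p}|cᵢ| - √(Σᵢ λᵢ⁻¹ yᵢ^{2/p})` of `P_{C,p}`. -/
noncomputable def Hobj {d : ℕ} (p : ℝ) (lam c : Fin d → ℝ) (y : Fin d → ℝ) : ℝ :=
  -∑ i, y i ^ (1 / p) * |c i| - Real.sqrt (∑ i, (lam i)⁻¹ * y i ^ (2 / p))

/-- The map `y ↦ x(y)` with `xᵢ = yᵢ^{1/p}·sign(cᵢ)`, where `sign(a) = 1` if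
`a ≥ 0` and `-1` otherwise. -/
noncomputable def xOf {d : ℕ} (p : ℝ) (c y : Fin d → ℝ) : Fin d → ℝ :=
  fun i => y i ^ (1 / p) * (if 0 ≤ c i then (1 : ℝ) else -1)

/-- The objective `G(x) = xᵀc + ‖x‖_{Λ⁻¹}` of `P_X`. -/
noncomputable def Gobj {d : ℕ} (lam c : Fin d → ℝ) (x : Fin d → ℝ) : ℝ :=
  x ⬝ᵥ c + mNorm (Matrix.diagonal lam)⁻¹ x

theorem mNorm_inv_diagonal {d : ℕ} {lam : Fin d → ℝ} (hpos : ∀ i, 0 < lam i) (x : Fin d → ℝ) :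
    mNorm (Matrix.diagonal lam)⁻¹ x = Real.sqrt (∑ i, (lam i)⁻¹ * x i ^ 2) := by
  have hinv : (Matrix.diagonal lam)⁻¹ = Matrix.diagonal fun i => (lam i)⁻¹ := by
    apply Matrix.inv_eq_left_inv
    rw [Matrix.diagonal_mul_diagonal, ← Matrix.diagonal_one]
    congr 1
    ext i
    exact inv_mul_cancel₀ (hpos i).ne'
  unfold mNorm
  rw [hinv]
  congr 1
  refine Finset.sum_congr rfl fun i _ => ?_
  rw [Matrix.mulVec_diagonal]
  ring

theorem rpow_two_div_eq_sq {a : ℝ} (ha : 0 ≤ a) (p : ℝ) : a ^ (2 / p) = (a ^ (1 / p)) ^ 2 := by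
  rw [← Real.rpow_natCast, ← Real.rpow_mul ha]
  congr 1
  push_cast
  ring

theorem pnorm_xOf {d : ℕ} {p : ℝ} (hp : 1 ≤ p) (c : Fin d → ℝ) {y : Fin d → ℝ}
    (hy : y ∈ stdSimplex' d) : pnorm p (xOf p c y) = 1 := by
  have hsum : ∑ i, |xOf p c y i| ^ p = 1 := by
    rw [← hy.2]
    refine Finset.sum_congr rfl fun i _ => ?_
    have habs : |xOf p c y i| = y i ^ (1 / p) := by
      unfold xOf
      rw [abs_mul, abs_of_nonneg (Real.rpow_nonneg (hy.1 i) _)]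
      split_ifs <;> simp
    rw [habs, ← Real.rpow_mul (hy.1 i), one_div_mul_cancel (by linarith), Real.rpow_one]
  rw [pnorm, hsum, Real.one_rpow]

theorem neg_Hobj_eq_Gobj_xOf {d : ℕ} (p : ℝ) {lam : Fin d → ℝ} (hpos : ∀ i, 0 < lam i)
    (c : Fin d → ℝ) {y : Fin d → ℝ} (hy : y ∈ stdSimplex' d) :
    -(Hobj p lam c y) = Gobj lam c (xOf p c y) := by
  have hlin : xOf p c y ⬝ᵥ c = ∑ i, y i ^ (1 / p) * |c i| := by
    refine Finset.sum_congr rfl fun i _ => ?_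
    unfold xOf
    split_ifs with h
    · rw [abs_of_nonneg h, mul_one]
    · rw [abs_of_neg (not_le.mp h)]
      ring
  have hquad : ∑ i, (lam i)⁻¹ * xOf p c y i ^ 2 = ∑ i, (lam i)⁻¹ * y i ^ (2 / p) := by
    refine Finset.sum_congr rfl fun i _ => ?_
    rw [rpow_two_div_eq_sq (hy.1 i)]
    unfold xOf
    split_ifs <;> ring
  rw [Gobj, mNorm_inv_diagonal hpos, hlin, hquad, Hobj]
  ring

theorem Gobj_le_neg_Hobj {d : ℕ} {p : ℝ} {lam : Fin d → ℝ} (hpos : ∀ i, 0 < lam i)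
    (c : Fin d → ℝ) {x z : Fin d → ℝ} (hz : ∀ i, 0 ≤ z i) (hxz : ∀ i, |x i| ≤ z i ^ (1 / p)) :
    Gobj lam c x ≤ -(Hobj p lam c z) := by
  have hlin : x ⬝ᵥ c ≤ ∑ i, z i ^ (1 / p) * |c i| := by
    refine Finset.sum_le_sum fun i _ => (le_abs_self _).trans ?_
    rw [abs_mul]
    exact mul_le_mul_of_nonneg_right (hxz i) (abs_nonneg _)
  have hquad : Real.sqrt (∑ i, (lam i)⁻¹ * x i ^ 2) ≤
      Real.sqrt (∑ i, (lam i)⁻¹ * z i ^ (2 / p)) := by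
    refine Real.sqrt_le_sqrt (Finset.sum_le_sum fun i _ => ?_)
    rw [rpow_two_div_eq_sq (hz i), ← sq_abs (x i)]
    exact mul_le_mul_of_nonneg_left (pow_le_pow_left₀ (abs_nonneg _) (hxz i) 2)
      (inv_nonneg.mpr (hpos i).le)
  rw [Gobj, mNorm_inv_diagonal hpos, Hobj]
  linarith

theorem exists_mem_stdSimplex'_abs_le {d : ℕ} [NeZero d] {p : ℝ} (hp : 1 ≤ p) {x : Fin d → ℝ}
    (hx : pnorm p x ≤ 1) : ∃ z ∈ stdSimplex' d, ∀ i, |x i| ≤ z i ^ (1 / p) := by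
  have hp0 : 0 < p := by linarith
  have hpow : ∀ i, 0 ≤ |x i| ^ p := fun i => Real.rpow_nonneg (abs_nonneg _) _
  have hS : ∑ i, |x i| ^ p ≤ 1 := by
    by_contra! h
    exact hx.not_gt (Real.one_lt_rpow h (by positivity))
  have hd : (d : ℝ) ≠ 0 := Nat.cast_ne_zero.mpr (NeZero.ne d)
  have hslack : 0 ≤ (1 - ∑ i, |x i| ^ p) / d := div_nonneg (by linarith) (Nat.cast_nonneg _)
  refine ⟨fun i => |x i| ^ p + (1 - ∑ i, |x i| ^ p) / d,
    ⟨fun i => add_nonneg (hpow i) hslack, ?_⟩, fun i => ?_⟩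
  · rw [Finset.sum_add_distrib, Finset.sum_const, Finset.card_univ, Fintype.card_fin,
      nsmul_eq_mul, mul_div_cancel₀ _ hd]
    ring
  · calc |x i| = (|x i| ^ p) ^ (1 / p) := by
          rw [← Real.rpow_mul (abs_nonneg _), mul_one_div_cancel hp0.ne', Real.rpow_one]
      _ ≤ _ := Real.rpow_le_rpow (hpow i) (le_add_of_nonneg_right hslack) (by positivity)

theorem bddBelow_Hobj_image {d : ℕ} {p : ℝ} (hp : 1 ≤ p) {lam : Fin d → ℝ}
    (hpos : ∀ i, 0 < lam i) (c : Fin d → ℝ) : BddBelow (Hobj p lam c '' stdSimplex' d) := by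
  refine ⟨-∑ i, |c i| - Real.sqrt (∑ i, (lam i)⁻¹), ?_⟩
  rintro _ ⟨z, hz, rfl⟩
  have hle : ∀ i, z i ≤ 1 := fun i =>
    hz.2 ▸ Finset.single_le_sum (fun j _ => hz.1 j) (Finset.mem_univ i)
  have hlin : ∑ i, z i ^ (1 / p) * |c i| ≤ ∑ i, |c i| :=
    Finset.sum_le_sum fun i _ => mul_le_of_le_one_left (abs_nonneg _)
      (Real.rpow_le_one (hz.1 i) (hle i) (by positivity))
  have hquad : Real.sqrt (∑ i, (lam i)⁻¹ * z i ^ (2 / p)) ≤ Real.sqrt (∑ i, (lam i)⁻¹) :=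
    Real.sqrt_le_sqrt <| Finset.sum_le_sum fun i _ =>
      mul_le_of_le_one_right (inv_nonneg.mpr (hpos i).le)
        (Real.rpow_le_one (hz.1 i) (hle i) (by positivity))
  rw [Hobj]
  linarith

theorem sSup_Gobj_eq_neg_sInf_Hobj {d : ℕ} [NeZero d] {p : ℝ} (hp : 1 ≤ p) {lam : Fin d → ℝ}
    (hpos : ∀ i, 0 < lam i) (c : Fin d → ℝ) (hne : (stdSimplex' d).Nonempty) :
    sSup (Gobj lam c '' {x : Fin d → ℝ | pnorm p x ≤ 1}) =
      -sInf (Hobj p lam c '' stdSimplex' d) := by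
  have hub : ∀ g ∈ Gobj lam c '' {x : Fin d → ℝ | pnorm p x ≤ 1},
      g ≤ -sInf (Hobj p lam c '' stdSimplex' d) := by
    rintro _ ⟨x, hx, rfl⟩
    obtain ⟨z, hz, hxz⟩ := exists_mem_stdSimplex'_abs_le hp hx
    have hG := Gobj_le_neg_Hobj hpos c hz.1 hxz
    have hH := csInf_le (bddBelow_Hobj_image hp hpos c) (mem_image_of_mem _ hz)
    linarith
  have hmem : ∀ z ∈ stdSimplex' d, xOf p c z ∈ {x : Fin d → ℝ | pnorm p x ≤ 1} :=
    fun z hz => (pnorm_xOf hp c hz).le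
  have hne' : (Gobj lam c '' {x : Fin d → ℝ | pnorm p x ≤ 1}).Nonempty :=
    hne.elim fun z hz => ⟨_, mem_image_of_mem _ (hmem z hz)⟩
  refine le_antisymm (csSup_le hne' hub) ?_
  rw [neg_le]
  refine le_csInf (hne.image _) ?_
  rintro _ ⟨z, hz, rfl⟩
  rw [neg_le, neg_Hobj_eq_Gobj_xOf p hpos c hz]
  exact le_csSup ⟨_, hub⟩ (mem_image_of_mem _ (hmem z hz))

/-- for `p ≥ 1`, `λ > 0` and `y` in the simplex, `‖x(y)‖_p = 1`,
`-H(y) = x(y)ᵀc + ‖x(y)‖_{Λ⁻¹}`, and `y` is an `ε`-minimizer of `H` over the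
simplex iff `x(y)` is an `ε`-maximizer of `x ↦ xᵀc + ‖x‖_{Λ⁻¹}` over the unit
`ℓ_p` ball. -/
theorem stmt13 {d : ℕ} (p : ℝ) (hp : 1 ≤ p) (lam : Fin d → ℝ) (hpos : ∀ i, 0 < lam i)
    (c : Fin d → ℝ) (ε : ℝ) (hε : 0 < ε)
    (y : Fin d → ℝ) (hy : y ∈ stdSimplex' d) :
    pnorm p (xOf p c y) = 1 ∧
    -(Hobj p lam c y) = Gobj lam c (xOf p c y) ∧
    ((Hobj p lam c y ≤ sInf (Hobj p lam c '' stdSimplex' d) + ε) ↔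
      (xOf p c y ∈ {x : Fin d → ℝ | pnorm p x ≤ 1} ∧
        sSup (Gobj lam c '' {x : Fin d → ℝ | pnorm p x ≤ 1}) - ε ≤ Gobj lam c (xOf p c y))) := by
  have : NeZero d := ⟨by
    rintro rfl
    simpa using hy.2⟩
  have hnorm := pnorm_xOf hp c hy
  have hval := neg_Hobj_eq_Gobj_xOf p hpos c hy
  refine ⟨hnorm, hval, ?_⟩
  rw [sSup_Gobj_eq_neg_sInf_Hobj hp hpos c ⟨y, hy⟩, ← hval]
  exact ⟨fun h => ⟨hnorm.le, by linarith⟩, fun h => by linarith [h.2]⟩
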